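/- Let G be a finite abelian group. Then the second integral homology group H₂(G, Z) is isomorphic to the exterior square G ∧ G (the quotient of G ⊗_Z G by the subgroup generated by elements g ⊗ g). -/

import Mathlib

open TensorProduct

/-- The bar differential `d₂ : ℤ[G²] → ℤ[G]`, `(g, h) ↦ (h) - (gh) + (g)`, of the
inhomogeneous chain complex computing group homology with trivial `ℤ`-coefficients. -/
noncomputable def barD2 (G : Type*) [Group G] : ((G × G) →₀ ℤ) →ₗ[ℤ] (G →₀ ℤ) :=
  Finsupp.lift (G →₀ ℤ) ℤ (G × G) fun p =>
    Finsupp.single p.2 1 - Finsupp.single (p.1 * p.2) 1 + Finsupp.single p.1 1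

/-- The bar differential `d₃ : ℤ[G³] → ℤ[G²]`,
`(g, h, k) ↦ (h, k) - (gh, k) + (g, hk) - (g, h)`. -/
noncomputable def barD3 (G : Type*) [Group G] : ((G × G × G) →₀ ℤ) →ₗ[ℤ] ((G × G) →₀ ℤ) :=
  Finsupp.lift ((G × G) →₀ ℤ) ℤ (G × G × G) fun t =>
    Finsupp.single (t.2.1, t.2.2) 1 - Finsupp.single (t.1 * t.2.1, t.2.2) 1 +
      Finsupp.single (t.1, t.2.1 * t.2.2) 1 - Finsupp.single (t.1, t.2.1) 1

/-- The second integral homology group `H₂(G, ℤ)` of a group `G`, defined as `2`-cycles modulo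
`2`-boundaries of the inhomogeneous bar complex with trivial `ℤ`-coefficients. -/
noncomputable def groupH2 (G : Type*) [Group G] : Type _ :=
  LinearMap.ker (barD2 G) ⧸
    Submodule.comap (LinearMap.ker (barD2 G)).subtype (LinearMap.range (barD3 G))

noncomputable instance (G : Type*) [Group G] : AddCommGroup (groupH2 G) :=
  Submodule.Quotient.addCommGroup _

/-- The alternating (exterior) square `A ∧ A` of an abelian group `A`: the quotient of
`A ⊗_ℤ A` by the subgroup generated by the elements `a ⊗ a`. -/
def wedgeSquare (A : Type*) [AddCommGroup A] : Type _ :=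
  (A ⊗[ℤ] A) ⧸ Submodule.span ℤ {x : A ⊗[ℤ] A | ∃ a : A, x = a ⊗ₜ[ℤ] a}

noncomputable instance (A : Type*) [AddCommGroup A] : AddCommGroup (wedgeSquare A) :=
  Submodule.Quotient.addCommGroup _

lemma lift_single_one {X N : Type*} [AddCommGroup N] (f : X → N) (x : X) :
    Finsupp.lift N ℤ X f (Finsupp.single x 1) = f x := by
  simp

/-- A symmetric (not necessarily normalized) `2`-cocycle on an abelian group `A` with values in an
abelian group `N`, for the trivial action. -/
structure SymmCocycle (A N : Type*) [AddCommGroup A] [AddCommGroup N] where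
  /-- The underlying function of two variables. -/
  toFun : A → A → N
  symm' : ∀ a b, toFun a b = toFun b a
  cocycle' : ∀ a b c, toFun b c + toFun a (b + c) = toFun (a + b) c + toFun a b

namespace SymmCocycle

variable {A N : Type*} [AddCommGroup A] [AddCommGroup N]

lemma zero_left (f : SymmCocycle A N) (a : A) : f.toFun 0 a = f.toFun 0 0 := by
  simpa using f.cocycle' 0 0 a

/-- The abelian extension of `A` by `N` attached to a symmetric `2`-cocycle. -/
@[ext]
structure Extension (f : SymmCocycle A N) where
  /-- The component in the quotient group. -/
  base : A
  /-- The component in the kernel. -/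
  fiber : N

namespace Extension

variable {f : SymmCocycle A N}

instance : Add (Extension f) :=
  ⟨fun x y => ⟨x.base + y.base, x.fiber + y.fiber + f.toFun x.base y.base⟩⟩
instance : Zero (Extension f) := ⟨⟨0, -f.toFun 0 0⟩⟩
instance : Neg (Extension f) :=
  ⟨fun x => ⟨-x.base, -x.fiber - f.toFun (-x.base) x.base - f.toFun 0 0⟩⟩

@[simp] lemma base_add (x y : Extension f) : (x + y).base = x.base + y.base := rfl
@[simp] lemma fiber_add (x y : Extension f) :
    (x + y).fiber = x.fiber + y.fiber + f.toFun x.base y.base := rfl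
@[simp] lemma base_zero : (0 : Extension f).base = 0 := rfl
@[simp] lemma fiber_zero : (0 : Extension f).fiber = -f.toFun 0 0 := rfl
@[simp] lemma base_neg (x : Extension f) : (-x).base = -x.base := rfl
@[simp] lemma fiber_neg (x : Extension f) :
    (-x).fiber = -x.fiber - f.toFun (-x.base) x.base - f.toFun 0 0 := rfl

protected lemma add_comm (x y : Extension f) : x + y = y + x := by
  ext
  · simp [add_comm]
  · simp [add_comm x.fiber, f.symm' x.base]

protected lemma zero_add (x : Extension f) : 0 + x = x := by
  ext <;> simp [f.zero_left]

instance : AddCommGroup (Extension f) where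
  add_assoc x y z := by
    ext
    · simp [add_assoc]
    · have h := f.cocycle' x.base y.base z.base
      simp only [fiber_add, base_add]
      calc _ = x.fiber + y.fiber + z.fiber +
            (f.toFun (x.base + y.base) z.base + f.toFun x.base y.base) := by abel
        _ = _ := by rw [← h]; abel
  zero_add := Extension.zero_add
  add_zero x := by rw [Extension.add_comm, Extension.zero_add]
  nsmul := nsmulRec
  zsmul := zsmulRec
  neg_add_cancel x := by
    ext
    · simp
    · simp only [fiber_add, fiber_neg, base_neg, fiber_zero]
      abel
  add_comm := Extension.add_comm

/-- The inclusion of the kernel `N` into the extension. -/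
def inl (f : SymmCocycle A N) : N →+ Extension f :=
  AddMonoidHom.mk' (fun n => ⟨0, n - f.toFun 0 0⟩) fun m n => by
    ext
    · simp
    · simp only [fiber_add]
      abel

lemma inl_injective (f : SymmCocycle A N) : Function.Injective (inl f) := fun m n h => by
  simpa [inl] using congrArg fiber h

lemma inl_cocycle (f : SymmCocycle A N) (a b : A) :
    inl f (f.toFun a b) = (⟨b, 0⟩ : Extension f) - ⟨a + b, 0⟩ + ⟨a, 0⟩ := by
  have h : (⟨b, 0⟩ : Extension f) + ⟨a, 0⟩ = inl f (f.toFun a b) + ⟨a + b, 0⟩ := by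
    ext
    · simp [inl, add_comm]
    · simp [inl, f.zero_left, f.symm' b a]
  rw [sub_add_eq_add_sub, h, add_sub_cancel_right]

end Extension

/-- A symmetric cocycle, extended linearly, vanishes on all `2`-cycles. -/
lemma lift_eq_zero_of_barD2_eq_zero (f : SymmCocycle A N)
    {x : (Multiplicative A × Multiplicative A) →₀ ℤ} (hx : barD2 (Multiplicative A) x = 0) :
    Finsupp.lift N ℤ _ (fun p => f.toFun p.1.toAdd p.2.toAdd) x = 0 := by
  have key : (Extension.inl f).toIntLinearMap ∘ₗ
        Finsupp.lift N ℤ _ (fun p : Multiplicative A × Multiplicative A =>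
          f.toFun p.1.toAdd p.2.toAdd) =
      Finsupp.lift (Extension f) ℤ _ (fun g : Multiplicative A => ⟨g.toAdd, 0⟩) ∘ₗ
        barD2 (Multiplicative A) := by
    refine Finsupp.lhom_ext' fun p => LinearMap.ext_ring ?_
    simp only [LinearMap.comp_apply, Finsupp.lsingle_apply, barD2, lift_single_one, map_add,
      map_sub, AddMonoidHom.coe_toIntLinearMap, Extension.inl_cocycle, toAdd_mul]
  apply Extension.inl_injective f
  simpa [hx] using LinearMap.congr_fun key x

end SymmCocycle

section

/-- The chain `(a, b) - (b, a)`. -/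
noncomputable def commutatorChain {A : Type*} (a b : A) :
    (Multiplicative A × Multiplicative A) →₀ ℤ :=
  Finsupp.single (.ofAdd a, .ofAdd b) 1 - Finsupp.single (.ofAdd b, .ofAdd a) 1

lemma commutatorChain_swap {A : Type*} (a b : A) : commutatorChain a b = -commutatorChain b a := by
  simp [commutatorChain]

variable {A : Type*} [AddCommGroup A]

lemma barD2_commutatorChain (a b : A) : barD2 (Multiplicative A) (commutatorChain a b) = 0 := by
  simp only [commutatorChain, barD2, map_sub, Finsupp.lift_apply, Finsupp.sum_single_index,
    zero_smul, one_smul, mul_comm (Multiplicative.ofAdd a)]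
  abel

lemma barD3_single (a b c : A) :
    barD3 (Multiplicative A) (Finsupp.single (.ofAdd a, .ofAdd b, .ofAdd c) 1) =
      Finsupp.single (.ofAdd b, .ofAdd c) 1 - Finsupp.single (.ofAdd (a + b), .ofAdd c) 1 +
        Finsupp.single (.ofAdd a, .ofAdd (b + c)) 1 - Finsupp.single (.ofAdd a, .ofAdd b) 1 := by
  simp [barD3]

lemma commutatorChain_add_left (a a' b : A) :
    commutatorChain (a + a') b - (commutatorChain a b + commutatorChain a' b) ∈
      LinearMap.range (barD3 (Multiplicative A)) := by
  refine ⟨Finsupp.single (.ofAdd a, .ofAdd b, .ofAdd a') 1 -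
    Finsupp.single (.ofAdd a, .ofAdd a', .ofAdd b) 1 -
    Finsupp.single (.ofAdd b, .ofAdd a, .ofAdd a') 1, ?_⟩
  simp only [map_sub, barD3_single, commutatorChain, add_comm b]
  abel

/-- The homology class of `(a, b) - (b, a)`. -/
noncomputable def commutatorClass (a b : A) : groupH2 (Multiplicative A) :=
  Submodule.Quotient.mk ⟨commutatorChain a b, barD2_commutatorChain a b⟩

lemma commutatorClass_add_left (a a' b : A) :
    commutatorClass (a + a') b = commutatorClass a b + commutatorClass a' b :=
  (Submodule.Quotient.eq _).2 (commutatorChain_add_left a a' b)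

lemma commutatorClass_swap (a b : A) : commutatorClass a b = -commutatorClass b a :=
  congrArg Submodule.Quotient.mk (Subtype.ext (commutatorChain_swap a b))

lemma commutatorClass_self (a : A) : commutatorClass a a = 0 :=
  (Submodule.Quotient.mk_eq_zero _).2 (by simp [commutatorChain])

lemma commutatorClass_add_right (a b b' : A) :
    commutatorClass a (b + b') = commutatorClass a b + commutatorClass a b' := by
  rw [commutatorClass_swap, commutatorClass_add_left, neg_add, ← commutatorClass_swap,
    ← commutatorClass_swap]

/-- The class of `a ⊗ b` in the exterior square. -/
def wedge (a b : A) : wedgeSquare A := Submodule.Quotient.mk (a ⊗ₜ[ℤ] b)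

/-- The wedge product as a biadditive map. -/
noncomputable def wedgeHom : A →+ A →+ wedgeSquare A :=
  AddMonoidHom.mk' (fun a => AddMonoidHom.mk' (wedge a) fun b b' =>
    congrArg Submodule.Quotient.mk (tmul_add a b b')) fun a a' =>
    AddMonoidHom.ext fun b => congrArg Submodule.Quotient.mk (add_tmul a a' b)

lemma wedgeHom_self (a : A) : wedgeHom a a = 0 :=
  (Submodule.Quotient.mk_eq_zero _).2 (Submodule.subset_span ⟨a, rfl⟩)

lemma wedgeHom_swap (a b : A) : wedgeHom a b = -wedgeHom b a := by
  have h := wedgeHom_self (a + b)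
  simp only [map_add, AddMonoidHom.add_apply, wedgeHom_self, zero_add, add_zero] at h
  exact eq_neg_of_add_eq_zero_right h

/-- The homology class of `(a, b) - (b, a)` as a bilinear map. -/
noncomputable def commutatorBilin : A →ₗ[ℤ] A →ₗ[ℤ] groupH2 (Multiplicative A) :=
  LinearMap.mk₂ ℤ commutatorClass commutatorClass_add_left
    (fun n a b => map_zsmul (AddMonoidHom.mk' (commutatorClass · b)
      fun a a' => commutatorClass_add_left a a' b) n a)
    commutatorClass_add_right
    (fun n a b => map_zsmul (AddMonoidHom.mk' (commutatorClass a)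
      (commutatorClass_add_right a)) n b)

variable (A) in
/-- The homomorphism `A ∧ A → H₂(A, ℤ)`, `a ∧ b ↦ [(a, b) - (b, a)]`. -/
noncomputable def wedgeToH2 : wedgeSquare A →+ groupH2 (Multiplicative A) :=
  (Submodule.liftQ _ (TensorProduct.lift commutatorBilin)
    (Submodule.span_le.2 (by
      rintro _ ⟨a, rfl⟩
      exact commutatorClass_self a))).toAddMonoidHom

lemma wedgeSquare_hom_ext {N : Type*} [AddCommGroup N] {f g : wedgeSquare A →+ N}
    (h : ∀ a b, f (wedgeHom a b) = g (wedgeHom a b)) : f = g := by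
  refine AddMonoidHom.ext fun x => ?_
  obtain ⟨x, rfl⟩ := Submodule.Quotient.mk_surjective _ x
  induction x with
  | zero => exact (map_zero f).trans (map_zero g).symm
  | tmul a b => exact h a b
  | add x y hx hy =>
    exact (map_add f _ _).trans ((congrArg₂ (· + ·) hx hy).trans (map_add g _ _).symm)

lemma ker_barD2_le : LinearMap.ker (barD2 (Multiplicative A)) ≤
    LinearMap.range (barD3 (Multiplicative A)) ⊔
      Submodule.span ℤ (Set.range fun p : A × A => commutatorChain p.1 p.2) := by
  intro x hx
  set S := LinearMap.range (barD3 (Multiplicative A)) ⊔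
    Submodule.span ℤ (Set.range fun p : A × A => commutatorChain p.1 p.2)
  let f : SymmCocycle A (((Multiplicative A × Multiplicative A) →₀ ℤ) ⧸ S) :=
    { toFun a b := S.mkQ (Finsupp.single (.ofAdd a, .ofAdd b) 1)
      symm' a b := (Submodule.Quotient.eq S).2
        (Submodule.mem_sup_right (Submodule.subset_span ⟨(a, b), rfl⟩))
      cocycle' a b c := by
        rw [← map_add, ← map_add]
        refine (Submodule.Quotient.eq S).2 (Submodule.mem_sup_left
          ⟨Finsupp.single (.ofAdd a, .ofAdd b, .ofAdd c) 1, ?_⟩)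
        rw [barD3_single]
        abel }
  have hf : Finsupp.lift _ ℤ _ (fun p => f.toFun p.1.toAdd p.2.toAdd) = S.mkQ := by
    ext p
    simp [f]
  have := f.lift_eq_zero_of_barD2_eq_zero hx
  rwa [hf, Submodule.mkQ_apply, Submodule.Quotient.mk_eq_zero] at this

lemma wedgeToH2_surjective : Function.Surjective (wedgeToH2 A) := by
  intro y
  obtain ⟨⟨x, hx⟩, rfl⟩ := Submodule.Quotient.mk_surjective _ y
  obtain ⟨u, hu, v, hv, rfl⟩ := Submodule.mem_sup.1 (ker_barD2_le hx)
  have hspan : ∀ v ∈ Submodule.span ℤ (Set.range fun p : A × A => commutatorChain p.1 p.2),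
      ∃ (h : v ∈ LinearMap.ker (barD2 (Multiplicative A))) (w : wedgeSquare A),
        wedgeToH2 A w = Submodule.Quotient.mk ⟨v, h⟩ := by
    intro v hv
    induction hv using Submodule.span_induction with
    | mem v hv =>
      obtain ⟨⟨a, b⟩, rfl⟩ := hv
      exact ⟨barD2_commutatorChain a b, wedgeHom a b, rfl⟩
    | zero => exact ⟨zero_mem _, 0, map_zero _⟩
    | add x y _ _ hx hy =>
      obtain ⟨hx, w, hw⟩ := hx
      obtain ⟨hy, w', hw'⟩ := hy
      exact ⟨add_mem hx hy, w + w', (map_add _ _ _).trans (congrArg₂ (· + ·) hw hw')⟩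
    | smul n x _ hx =>
      obtain ⟨hx, w, hw⟩ := hx
      exact ⟨Submodule.smul_mem _ n hx, n • w,
        (map_zsmul _ _ _).trans (congrArg (n • ·) hw)⟩
  obtain ⟨_, w, hw⟩ := hspan v hv
  refine ⟨w, hw.trans ((Submodule.Quotient.eq _).2 ?_)⟩
  simpa using hu

/-- The homomorphism `H₂(A, ℤ) → N` induced by a biadditive map `A × A → N`. -/
noncomputable def h2Lift {N : Type*} [AddCommGroup N] (β : A →+ A →+ N) :
    groupH2 (Multiplicative A) →+ N :=
  (Submodule.liftQ _
    (Finsupp.lift N ℤ _ (fun p : Multiplicative A × Multiplicative A => β p.1.toAdd p.2.toAdd) ∘ₗ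
      (LinearMap.ker (barD2 (Multiplicative A))).subtype) (by
    have h : Finsupp.lift N ℤ _ (fun p : Multiplicative A × Multiplicative A => β p.1.toAdd p.2.toAdd) ∘ₗ
        barD3 (Multiplicative A) = 0 := by
      refine Finsupp.lhom_ext' fun p => LinearMap.ext_ring ?_
      simp only [LinearMap.comp_apply, Finsupp.lsingle_apply, barD3, lift_single_one, map_add,
        map_sub, toAdd_mul, AddMonoidHom.add_apply, LinearMap.zero_apply]
      abel
    rintro ⟨x, hx⟩ ⟨y, rfl⟩
    exact LinearMap.congr_fun h y)).toAddMonoidHom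

lemma h2Lift_commutatorClass {N : Type*} [AddCommGroup N] (β : A →+ A →+ N) (a b : A) :
    h2Lift β (commutatorClass a b) = β a b - β b a := by
  change Finsupp.lift N ℤ _ (fun p : Multiplicative A × Multiplicative A => β p.1.toAdd p.2.toAdd)
    (commutatorChain a b) = _
  simp only [commutatorChain, map_sub, lift_single_one, toAdd_ofAdd]

lemma wedgeToH2_injective (β : A →+ A →+ wedgeSquare A)
    (hβ : ∀ a b, β a b - β b a = wedgeHom a b) : Function.Injective (wedgeToH2 A) := by
  have h : (h2Lift β).comp (wedgeToH2 A) = AddMonoidHom.id _ :=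
    wedgeSquare_hom_ext fun a b => (h2Lift_commutatorClass β a b).trans (hβ a b)
  exact Function.LeftInverse.injective (DFunLike.congr_fun h)

/-- The identity of a finite abelian group is a finite sum of endomorphisms with cyclic image. -/
lemma exists_sum_cyclic_eq_id (A : Type*) [AddCommGroup A] [Finite A] :
    ∃ (n : ℕ) (π : Fin n → A →+ A) (g : Fin n → A),
      ∑ i, π i = AddMonoidHom.id A ∧ ∀ i a, ∃ k : ℤ, π i a = k • g i := by
  obtain ⟨ι, _, p, _, e, ⟨f⟩⟩ := AddCommGroup.equiv_directSum_zmod_of_finite A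
  classical
  let σ := (Fintype.equivFin ι).symm
  refine ⟨Fintype.card ι, fun i => f.symm.toAddMonoidHom.comp
    ((DirectSum.of _ (σ i)).comp ((DFinsupp.evalAddMonoidHom (σ i)).comp f.toAddMonoidHom)),
    fun i => f.symm (DirectSum.of _ (σ i) 1), ?_, fun i a => ?_⟩
  · ext a
    apply f.injective
    simp only [AddMonoidHom.finsetSum_apply, map_sum]
    rw [Equiv.sum_comp σ (fun i => f ((f.symm.toAddMonoidHom.comp
      ((DirectSum.of _ i).comp ((DFinsupp.evalAddMonoidHom i).comp f.toAddMonoidHom))) a))]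
    simp only [AddMonoidHom.comp_apply, AddEquiv.coe_toAddMonoidHom, AddEquiv.apply_symm_apply]
    exact DirectSum.sum_univ_of (f a)
  · obtain ⟨k, hk⟩ := ZMod.intCast_surjective (f a (σ i))
    refine ⟨k, ?_⟩
    rw [← map_zsmul, ← map_zsmul]
    rw [zsmul_one, hk]
    rfl

lemma exists_antisymmetrization_eq_wedge (A : Type*) [AddCommGroup A] [Finite A] :
    ∃ β : A →+ A →+ wedgeSquare A, ∀ a b, β a b - β b a = wedgeHom a b := by
  obtain ⟨n, π, g, hsum, hg⟩ := exists_sum_cyclic_eq_id A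
  have hdiag (i a b) : wedgeHom (π i a) (π i b) = 0 := by
    obtain ⟨k, hk⟩ := hg i a
    obtain ⟨l, hl⟩ := hg i b
    simp [hk, hl, wedgeHom_self]
  have hid (a : A) : ∑ i, π i a = a := by
    simpa using DFunLike.congr_fun hsum a
  refine ⟨∑ i, ∑ j, if i < j then (wedgeHom.compl₂ (π j)).comp (π i) else 0, fun a b => ?_⟩
  have hβ (a b : A) : (∑ i, ∑ j, if i < j then (wedgeHom.compl₂ (π j)).comp (π i) else 0) a b =
      ∑ i, ∑ j, if i < j then wedgeHom (π i a) (π j b) else 0 := by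
    simp only [AddMonoidHom.finsetSum_apply]
    refine Finset.sum_congr rfl fun i _ => Finset.sum_congr rfl fun j _ => ?_
    split_ifs <;> rfl
  rw [hβ, hβ, Finset.sum_comm (f := fun i j => if i < j then wedgeHom (π i b) (π j a) else 0)]
  conv_rhs => rw [← hid a, ← hid b]
  simp only [map_sum, AddMonoidHom.finsetSum_apply, ← Finset.sum_sub_distrib]
  rw [Finset.sum_comm]
  refine Finset.sum_congr rfl fun j _ => Finset.sum_congr rfl fun i _ => ?_
  rcases lt_trichotomy i j with h | rfl | h
  · simp [h, h.not_gt]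
  · simp [hdiag]
  · simp [h, h.not_gt, wedgeHom_swap (π j b)]

end

/-- For a finite abelian group `A`, the second integral homology `H₂(A, ℤ)` (the Schur
multiplier) is isomorphic to the exterior square `A ∧ A`. -/
theorem groupH2_iso_wedgeSquare (A : Type*) [AddCommGroup A] [Finite A] :
    Nonempty (groupH2 (Multiplicative A) ≃+ wedgeSquare A) := by
  obtain ⟨β, hβ⟩ := exists_antisymmetrization_eq_wedge A
  exact ⟨(AddEquiv.ofBijective (wedgeToH2 A)
    ⟨wedgeToH2_injective β hβ, wedgeToH2_surjective⟩).symm⟩
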